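/- Let m ≥ 2 be an integer, a an integer with 0 ≤ a ≤ m−2, N a positive integer, and M an integer coprime to N. Then lim_{t → 0+} m Σ_{n=0}^{∞} χ_{2m}^{(a)}(n) e^{π i M n² / (2mN)} e^{−n² t} = m Σ_{n=0}^{mN} χ_{2m}^{(a)}(n) ( 1 − n/(mN) ) e^{π i M n² / (2mN)}. In other words, the Eichler integral Φ̃_m^{(a)}(τ) = m Σ_{n=0}^{∞} χ_{2m}^{(a)}(n) e^{π i n² τ/(2m)}, defined for τ in the upper half-plane, has the radial limit at the rational point τ = M/N given by the stated finite sum. -/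

import Mathlib

open scoped Real BigOperators
open Complex (I)

/-- The odd periodic function `χ_{2m}^{(a)} : ℤ → ℂ` with period `2m`, taking the value
`+1` at `n ≡ m−1−a (mod 2m)`, `−1` at `n ≡ m+1+a (mod 2m)`, and `0` otherwise. -/
def chi (m a : ℕ) (n : ℤ) : ℂ :=
  if (n : ZMod (2 * m)) = ((m - 1 - a : ℕ) : ZMod (2 * m)) then 1
  else if (n : ZMod (2 * m)) = ((m + 1 + a : ℕ) : ZMod (2 * m)) then -1
  else 0

/-- The prefix sums of a periodic sequence whose sum over a period vanishes are periodic. -/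
lemma periodic_sum_range {f : ℕ → ℂ} {P : ℕ} (hf : Function.Periodic f P)
    (h0 : ∑ k ∈ Finset.range P, f k = 0) :
    Function.Periodic (fun n => ∑ k ∈ Finset.range n, f k) P := by
  intro n
  induction n with
  | zero => simpa using h0
  | succ n ih =>
    simp only at ih ⊢
    rw [show n + 1 + P = n + P + 1 by ring, Finset.sum_range_succ, Finset.sum_range_succ, ih,
      hf n]

lemma exists_norm_le_of_periodic {f : ℕ → ℂ} {P : ℕ} (hP : 0 < P)
    (hf : Function.Periodic f P) : ∃ C, 0 ≤ C ∧ ∀ n, ‖f n‖ ≤ C := by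
  refine ⟨∑ k ∈ Finset.range P, ‖f k‖, Finset.sum_nonneg fun _ _ => norm_nonneg _, fun n => ?_⟩
  rw [← hf.map_mod_nat n]
  exact Finset.single_le_sum (f := fun k => ‖f k‖) (fun _ _ => norm_nonneg _)
    (Finset.mem_range.2 (Nat.mod_lt _ hP))

lemma summable_exp_neg_sq_mul {t : ℝ} (ht : 0 < t) :
    Summable fun n : ℕ => Real.exp (-((n : ℝ) ^ 2) * t) := by
  refine Summable.of_nonneg_of_le (fun _ => (Real.exp_pos _).le) (fun n => ?_)
    (Real.summable_exp_nat_mul_iff.2 (neg_lt_zero.2 ht))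
  have h : (n : ℝ) ≤ (n : ℝ) ^ 2 := by exact_mod_cast Nat.le_self_pow two_ne_zero n
  exact Real.exp_le_exp.2 (by nlinarith)

/-- A second difference is bounded by any bound for the second derivative. -/
lemma abs_second_difference_le {G G' G'' : ℝ → ℝ} {x C : ℝ}
    (hG : ∀ y, HasDerivAt G (G' y) y) (hG' : ∀ y, HasDerivAt G' (G'' y) y)
    (hC : ∀ y, x ≤ y → |G'' y| ≤ C) : |G x - 2 * G (x + 1) + G (x + 2)| ≤ C := by
  have key : ∀ y, x ≤ y → ‖G' (y + 1) - G' y‖ ≤ C := fun y hy => by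
    have := (convex_Icc y (y + 1)).norm_image_sub_le_of_norm_hasDerivWithin_le
      (f := G') (f' := G'') (C := C) (x := y) (y := y + 1)
      (fun z _ => (hG' z).hasDerivWithinAt) (fun z hz => hC z (hy.trans hz.1))
      (by simp) (by simp)
    simpa using this
  have hK : ∀ y, HasDerivAt (fun y => G (y + 1) - G y) (G' (y + 1) - G' y) y := fun y =>
    ((hG (y + 1)).comp_add_const y 1).sub (hG y)
  have := (convex_Icc x (x + 1)).norm_image_sub_le_of_norm_hasDerivWithin_le
      (C := C) (x := x) (y := x + 1)
      (fun z _ => (hK z).hasDerivWithinAt) (fun z hz => key z hz.1) (by simp) (by simp)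
  rw [Real.norm_eq_abs] at this
  have e : G (x + 1 + 1) - G (x + 1) - (G (x + 1) - G x)
      = G x - 2 * G (x + 1) + G (x + 2) := by
    rw [show x + 1 + 1 = x + 2 by ring]; ring
  rw [e] at this
  simpa using this

/-- The second differences of `n ↦ exp (-n² t)` are `O(n⁻²)`, uniformly in `t > 0`. -/
lemma abs_second_difference_exp_neg_sq_mul_le {t x : ℝ} (ht : 0 < t) (hx : 0 < x) :
    |Real.exp (-(x ^ 2) * t) - 2 * Real.exp (-((x + 1) ^ 2) * t)
      + Real.exp (-((x + 2) ^ 2) * t)| ≤ 8 / x ^ 2 := by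
  have hG : ∀ y : ℝ, HasDerivAt (fun y => Real.exp (-(y ^ 2) * t))
      (-(2 * y * t) * Real.exp (-(y ^ 2) * t)) y := fun y => by
    have := (((hasDerivAt_id y).pow 2).neg.mul_const t).exp
    refine this.congr_deriv ?_
    simp; ring
  have hG' : ∀ y : ℝ, HasDerivAt (fun y => -(2 * y * t) * Real.exp (-(y ^ 2) * t))
      ((4 * y ^ 2 * t ^ 2 - 2 * t) * Real.exp (-(y ^ 2) * t)) y := fun y => by
    have := ((((hasDerivAt_id y).const_mul 2).mul_const t).neg).mul (hG y)
    refine this.congr_deriv ?_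
    simp; ring
  refine abs_second_difference_le (G := fun y => Real.exp (-(y ^ 2) * t)) hG hG' fun y hy => ?_
  have hy0 : 0 < y := hx.trans_le hy
  have hu : 0 ≤ y ^ 2 * t := by positivity
  have hq := Real.quadratic_le_exp_of_nonneg hu
  have hle : |(4 * y ^ 2 * t ^ 2 - 2 * t) * Real.exp (-(y ^ 2) * t)| ≤ 8 / y ^ 2 := by
    rw [le_div_iff₀ (by positivity), abs_mul, abs_of_pos (Real.exp_pos _), neg_mul, Real.exp_neg,
      ← div_eq_mul_inv, div_mul_eq_mul_div, div_le_iff₀ (Real.exp_pos _)]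
    refine le_trans ?_ (mul_le_mul_of_nonneg_left hq (by norm_num))
    rw [← abs_of_pos (show (0 : ℝ) < y ^ 2 by positivity), ← abs_mul,
      abs_of_pos (show (0 : ℝ) < y ^ 2 by positivity),
      show (4 * y ^ 2 * t ^ 2 - 2 * t) * y ^ 2 = 4 * (y ^ 2 * t) ^ 2 - 2 * (y ^ 2 * t) by ring]
    exact abs_le.2 ⟨by nlinarith [sq_nonneg (y ^ 2 * t)], by nlinarith⟩
  exact hle.trans (by gcongr)

/-- Double summation by parts. -/
lemma tsum_second_difference_mul {U g : ℕ → ℂ} {C : ℝ} (hU : ∀ n, ‖U n‖ ≤ C)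
    (hg : Summable fun n => ‖g n‖) :
    ∑' n, (U (n + 2) - 2 * U (n + 1) + U n) * g n
      = (∑' n, U (n + 2) * (g n - 2 * g (n + 1) + g (n + 2)))
        + (U 0 * g 0 + U 1 * g 1 - 2 * U 1 * g 0) := by
  have hs : ∀ i j : ℕ, Summable fun n => U (n + i) * g (n + j) := fun i j => by
    refine Summable.of_norm_bounded (((summable_nat_add_iff j).2 hg).mul_left C) fun n => ?_
    rw [norm_mul]
    exact mul_le_mul_of_nonneg_right (hU _) (norm_nonneg _)
  set Q : ℕ → ℂ := fun n => 2 * (U (n + 1) * g n) - U n * g n - U (n + 1) * g (n + 1) with hQ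
  have hQs : Summable Q := (((hs 1 0).mul_left 2).sub (hs 0 0)).sub (hs 1 1)
  have hQs' : Summable fun n => Q (n + 1) := (summable_nat_add_iff 1).2 hQs
  have hd : Summable fun n => U (n + 2) * (g n - 2 * g (n + 1) + g (n + 2)) :=
    (((hs 2 0).sub ((hs 2 1).mul_left 2)).add (hs 2 2)).congr fun n => by
      simp only [add_zero]; ring
  have hfun : ∀ n, (U (n + 2) - 2 * U (n + 1) + U n) * g n
      = U (n + 2) * (g n - 2 * g (n + 1) + g (n + 2)) + (Q (n + 1) - Q n) := fun n => by
    simp only [hQ, add_assoc, one_add_one_eq_two]; ring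
  rw [tsum_congr hfun, hd.tsum_add (hQs'.sub hQs), hQs'.tsum_sub hQs, hQs.tsum_eq_zero_add]
  simp only [hQ, zero_add]
  ring

/-- The sum of a periodic sequence of mean value zero, regularized by `exp (-n² t)`, tends to
the value at `0` of its Dirichlet series. -/
lemma tendsto_tsum_periodic_mul_exp_neg_sq {f : ℕ → ℂ} {P : ℕ} (hP : 0 < P)
    (hf : Function.Periodic f P) (h0 : ∑ k ∈ Finset.range P, f k = 0) :
    Filter.Tendsto (fun t : ℝ => ∑' n : ℕ, f n * (Real.exp (-((n : ℝ) ^ 2) * t) : ℝ))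
      (nhdsWithin 0 (Set.Ioi 0)) (nhds (-(∑ k ∈ Finset.range P, k * f k) / P)) := by
  have hPc : (P : ℂ) ≠ 0 := by exact_mod_cast hP.ne'
  set S : ℕ → ℂ := fun n => ∑ k ∈ Finset.range n, f k with hS
  have hSP : Function.Periodic S P := periodic_sum_range hf h0
  have hSsum : ∀ n : ℕ, ∑ k ∈ Finset.range n, S k
      = n * S n - ∑ k ∈ Finset.range n, (k + 1) * f k := fun n => by
    induction n with
    | zero => simp
    | succ n ih =>
      rw [Finset.sum_range_succ, ih, Finset.sum_range_succ _ n]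
      simp only [hS, Finset.sum_range_succ]
      push_cast
      ring
  set μ : ℂ := -(∑ k ∈ Finset.range P, k * f k) / P with hμ
  have hSμ : ∑ k ∈ Finset.range P, (S k - μ) = 0 := by
    have h1 : S P = 0 := h0
    rw [Finset.sum_sub_distrib, hSsum, h1]
    simp only [add_mul, one_mul, Finset.sum_add_distrib, h0, Finset.sum_const, Finset.card_range,
      nsmul_eq_mul, hμ]
    field_simp
    ring
  set U : ℕ → ℂ := fun n => ∑ k ∈ Finset.range n, (S k - μ) with hU
  have hUP : Function.Periodic U P :=
    periodic_sum_range (f := fun k => S k - μ) (fun n => by simp only [hSP n]) hSμ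
  obtain ⟨C, hC0, hC⟩ := exists_norm_le_of_periodic hP hUP
  have hfU : ∀ n, f n = U (n + 2) - 2 * U (n + 1) + U n := fun n => by
    simp only [hU, hS, Finset.sum_range_succ]
    ring
  have hcont : ∀ n : ℕ, Filter.Tendsto (fun t : ℝ => ((Real.exp (-((n : ℝ) ^ 2) * t) : ℝ) : ℂ))
      (nhdsWithin 0 (Set.Ioi 0)) (nhds 1) := fun n => by
    have : Continuous fun t : ℝ => ((Real.exp (-((n : ℝ) ^ 2) * t) : ℝ) : ℂ) := by fun_prop
    simpa using (this.tendsto 0).mono_left nhdsWithin_le_nhds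
  have hlim : Filter.Tendsto (fun t : ℝ => ∑' n : ℕ, U (n + 2) *
      (((Real.exp (-((n : ℝ) ^ 2) * t) : ℝ) : ℂ)
        - 2 * ((Real.exp (-(((n + 1 : ℕ) : ℝ) ^ 2) * t) : ℝ) : ℂ)
        + ((Real.exp (-(((n + 2 : ℕ) : ℝ) ^ 2) * t) : ℝ) : ℂ)))
      (nhdsWithin 0 (Set.Ioi 0)) (nhds (∑' _ : ℕ, 0)) := by
    refine tendsto_tsum_of_dominated_convergence
      (bound := fun n : ℕ => if n = 0 then C * 4 else C * (8 / (n : ℝ) ^ 2)) ?_ (fun n => ?_) ?_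
    · rw [← summable_nat_add_iff 1]
      have h := (Real.summable_one_div_nat_pow.2 one_lt_two).mul_left (C * 8)
      refine ((summable_nat_add_iff 1).2 h).congr fun n => ?_
      rw [if_neg n.succ_ne_zero]
      ring
    · have h := (((hcont n).sub ((hcont (n + 1)).const_mul 2)).add (hcont (n + 2))).const_mul
        (U (n + 2))
      norm_num at h ⊢
      exact h
    · filter_upwards [self_mem_nhdsWithin] with t ht n
      have ht : 0 < t := ht
      rw [norm_mul]
      split_ifs with hn
      · refine mul_le_mul (hC _) ?_ (norm_nonneg _) hC0
        have h1 : ∀ k : ℕ, ‖((Real.exp (-((k : ℝ) ^ 2) * t) : ℝ) : ℂ)‖ ≤ 1 := fun k => by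
          rw [Complex.norm_real, Real.norm_eq_abs, abs_of_pos (Real.exp_pos _)]
          exact Real.exp_le_one_iff.2 (by nlinarith [sq_nonneg (k : ℝ)])
        refine (norm_add_le_of_le (norm_sub_le _ _) le_rfl).trans ?_
        rw [norm_mul, Complex.norm_ofNat]
        linarith [h1 n, h1 (n + 1), h1 (n + 2)]
      · refine mul_le_mul (hC _) ?_ (norm_nonneg _) hC0
        have h := abs_second_difference_exp_neg_sq_mul_le ht
          (show (0 : ℝ) < n by exact_mod_cast Nat.pos_of_ne_zero hn)
        rw [← Real.norm_eq_abs, ← Complex.norm_real] at h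
        push_cast at h ⊢
        exact h
  have hmain := hlim.add
    ((((hcont 0).const_mul (U 0)).add ((hcont 1).const_mul (U 1))).sub
      ((hcont 0).const_mul (2 * U 1)))
  have hval : (∑' _ : ℕ, (0 : ℂ)) + (U 0 * 1 + U 1 * 1 - 2 * U 1 * 1) = μ := by
    simp [hU, hS]
    ring
  rw [hval] at hmain
  refine hmain.congr' ?_
  filter_upwards [self_mem_nhdsWithin] with t ht
  have hg : Summable fun n : ℕ => ‖((Real.exp (-((n : ℝ) ^ 2) * t) : ℝ) : ℂ)‖ :=
    (summable_exp_neg_sq_mul ht).congr fun n => by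
      rw [Complex.norm_real, Real.norm_eq_abs, abs_of_pos (Real.exp_pos _)]
  rw [← tsum_second_difference_mul hC hg]
  exact tsum_congr fun n => by rw [hfU n]

lemma sum_range_two_mul_eq (F : ℕ → ℂ) (L : ℕ) :
    ∑ k ∈ Finset.range (2 * L), F k
      = (∑ k ∈ Finset.range (L + 1), (F k + F (2 * L - k))) - F L - F (2 * L) := by
  have h1 : ∑ k ∈ Finset.range (L + 1), F (2 * L - k)
      = ∑ k ∈ Finset.range (L + 1), F (L + k) := by
    rw [← Finset.sum_range_reflect]
    refine Finset.sum_congr rfl fun k hk => congrArg F ?_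
    have := Finset.mem_range.1 hk
    omega
  rw [Finset.sum_add_distrib, h1, Finset.sum_range_succ, Finset.sum_range_succ, two_mul,
    Finset.sum_range_add]
  ring

/-- For an odd `2L`-periodic sequence the limit is a sum over half a period. -/
lemma tendsto_tsum_odd_periodic_mul_exp_neg_sq {f : ℕ → ℂ} {L : ℕ} (hL : 0 < L)
    (hf : Function.Periodic f (2 * L)) (hodd : ∀ k ≤ 2 * L, f (2 * L - k) = -f k) :
    Filter.Tendsto (fun t : ℝ => ∑' n : ℕ, f n * (Real.exp (-((n : ℝ) ^ 2) * t) : ℝ))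
      (nhdsWithin 0 (Set.Ioi 0))
      (nhds (∑ k ∈ Finset.range (L + 1), f k * (1 - (k : ℂ) / L))) := by
  have hLc : (L : ℂ) ≠ 0 := by exact_mod_cast hL.ne'
  have hfL : f L = 0 := by
    have h := hodd L (by omega)
    rw [show 2 * L - L = L by omega] at h
    exact self_eq_neg.1 h
  have hf2L : f (2 * L) = 0 := by
    have h := hodd (2 * L) le_rfl
    have h' := hf 0
    rw [Nat.sub_self] at h
    rw [zero_add, h] at h'
    exact self_eq_neg.1 h'
  have h0 : ∑ k ∈ Finset.range (2 * L), f k = 0 := by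
    rw [sum_range_two_mul_eq, hfL, hf2L, sub_zero, sub_zero]
    refine Finset.sum_eq_zero fun k hk => ?_
    rw [hodd k (by have := Finset.mem_range.1 hk; omega), add_neg_cancel]
  convert tendsto_tsum_periodic_mul_exp_neg_sq (by omega : 0 < 2 * L) hf h0 using 2
  rw [sum_range_two_mul_eq (fun k => (k : ℂ) * f k), hfL, hf2L, mul_zero, mul_zero, sub_zero,
    sub_zero, ← Finset.sum_neg_distrib, Finset.sum_div]
  refine Finset.sum_congr rfl fun k hk => ?_
  have hk' : k ≤ 2 * L := by have := Finset.mem_range.1 hk; omega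
  rw [hodd k hk', Nat.cast_sub hk']
  push_cast
  field_simp
  ring

lemma chi_add_period (m a : ℕ) (n k : ℤ) : chi m a (n + 2 * m * k) = chi m a n := by
  have h : ((n + 2 * m * k : ℤ) : ZMod (2 * m)) = n := by
    have : ((2 * m : ℕ) : ZMod (2 * m)) = 0 := ZMod.natCast_self _
    push_cast at this ⊢
    rw [this]; ring
  simp only [chi, h]

lemma chi_neg {m a : ℕ} (hm : 2 ≤ m) (ha : a ≤ m - 2) (n : ℤ) : chi m a (-n) = -chi m a n := by
  have h2 : ((m + 1 + a : ℕ) : ZMod (2 * m)) = -((m - 1 - a : ℕ) : ZMod (2 * m)) := by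
    rw [eq_neg_iff_add_eq_zero, ← Nat.cast_add, show m + 1 + a + (m - 1 - a) = 2 * m by omega,
      ZMod.natCast_self]
  have hne : ((m - 1 - a : ℕ) : ZMod (2 * m)) ≠ ((m + 1 + a : ℕ) : ZMod (2 * m)) := by
    rw [Ne, ZMod.natCast_eq_natCast_iff', Nat.mod_eq_of_lt (by omega), Nat.mod_eq_of_lt (by omega)]
    omega
  unfold chi
  rw [h2] at hne ⊢
  simp only [Int.cast_neg, neg_eq_iff_eq_neg]
  by_cases h : (n : ZMod (2 * m)) = ((m - 1 - a : ℕ) : ZMod (2 * m))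
  · rw [h]; simp [hne]
  · by_cases h' : (n : ZMod (2 * m)) = -((m - 1 - a : ℕ) : ZMod (2 * m))
    · rw [h']; simp [hne.symm]
    · simp [h, h']

/-- for `m ≥ 2`, `0 ≤ a ≤ m−2`, `N ≥ 1` and `M` coprime to `N`, the
Eichler integral `Φ̃_m^{(a)}(τ) = m Σ_{n≥0} χ_{2m}^{(a)}(n) e^{πin²τ/(2m)}` has the
radial limit at `τ = M/N`:
`lim_{t→0+} m Σ_{n≥0} χ_{2m}^{(a)}(n) e^{πiMn²/(2mN)} e^{−n²t}
  = m Σ_{n=0}^{mN} χ_{2m}^{(a)}(n) (1 − n/(mN)) e^{πiMn²/(2mN)}`. -/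
theorem stmt11 (m a : ℕ) (hm : 2 ≤ m) (ha : a ≤ m - 2) (N : ℕ) (hN : 0 < N)
    (M : ℤ) (hMN : IsCoprime M (N : ℤ)) :
    Filter.Tendsto
      (fun t : ℝ =>
        (m : ℂ) * ∑' n : ℕ,
          chi m a n * Complex.exp ((π : ℂ) * I * M * (n : ℂ) ^ 2 / (2 * m * N)) *
            (Real.exp (-((n : ℝ) ^ 2) * t) : ℝ))
      (nhdsWithin 0 (Set.Ioi 0))
      (nhds ((m : ℂ) * ∑ n ∈ Finset.range (m * N + 1),
        chi m a n * (1 - (n : ℂ) / (m * N)) *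
          Complex.exp ((π : ℂ) * I * M * (n : ℂ) ^ 2 / (2 * m * N)))) := by
  have hmc : (m : ℂ) ≠ 0 := by exact_mod_cast (by omega : m ≠ 0)
  have hNc : (N : ℂ) ≠ 0 := by exact_mod_cast hN.ne'
  have hexp : ∀ (x y : ℂ) (j : ℤ), y ^ 2 = x ^ 2 + 4 * m * N * j →
      Complex.exp ((π : ℂ) * I * M * y ^ 2 / (2 * m * N))
        = Complex.exp ((π : ℂ) * I * M * x ^ 2 / (2 * m * N)) := fun x y j h => by
    rw [Complex.exp_eq_exp_iff_exists_int]
    refine ⟨M * j, ?_⟩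
    rw [h]
    push_cast
    field_simp
    ring
  refine Filter.Tendsto.const_mul _ ?_
  convert tendsto_tsum_odd_periodic_mul_exp_neg_sq (L := m * N) (by positivity)
    (f := fun n : ℕ => chi m a n * Complex.exp ((π : ℂ) * I * M * (n : ℂ) ^ 2 / (2 * m * N)))
    (fun n => ?_) (fun k hk => ?_) using 2
  · refine Finset.sum_congr rfl fun n _ => ?_
    push_cast
    ring
  · have h := chi_add_period m a n N
    beta_reduce
    rw [hexp n ((n + 2 * (m * N) : ℕ) : ℂ) (n + m * N) (by push_cast; ring), ← h]
    push_cast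
    ring_nf
  · have h := chi_add_period m a (-k) N
    rw [chi_neg hm ha] at h
    rw [hexp k ((2 * (m * N) - k : ℕ) : ℂ) (m * N - k)
      (by rw [Nat.cast_sub hk]; push_cast; ring), ← neg_mul, ← h, Nat.cast_sub hk]
    push_cast
    ring_nf
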